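/- Let n ≥ 3 be an integer and let ℓ be an integer with ℓ ≥ 300000·(log n)³. Let R_k be a finite set and let 𝒢 be a finite indexed family of subsets of R_k with |𝒢| ≤ nℓ such that |C| ≥ ℓ⁴/2 for every C ∈ 𝒢 and every element of R_k lies in at most ℓ members of 𝒢 (with multiplicity). Consider the probability space in which each element of R_k is independently kept with probability 1/ℓ, and let R_{k+1} denote the random set of kept elements. Then with probability at least 1 − 1/n^{10} the following holds simultaneously for every subfamily F ⊆ 𝒢, every α : F → ℕ with ℓ³/1000 ≤ α(C) ≤ n for all C ∈ F, and every integer γ with 1 ≤ γ ≤ ℓ: if there is an (α,γ)-good assignment of R_{k+1} to F, then there is an (α',γ)-good assignment of R_k to F for some α' : F → ℕ satisfying α'(C) ≥ ℓ·(1 − 1/log n)·α(C) for all C ∈ F. -/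

import Mathlib

open MeasureTheory

/-- The Bernoulli(p) measure on `Bool`: mass `p` on `true` and `1 - p` on `false`. -/
noncomputable def bernoulliMeasure (p : ENNReal) : Measure Bool :=
  p • Measure.dirac true + (1 - p) • Measure.dirac false

/-- The product measure on `S → Bool` in which each coordinate is independently
`true` (kept) with probability `p`. -/
noncomputable def keepMeasure (S : Type) [Fintype S] (p : ENNReal) :
    Measure (S → Bool) :=
  Measure.pi fun _ : S => bernoulliMeasure p

/-- A `(β,γ)`-good assignment of `R'` to the subfamily `F` of the indexed family `G`:
each `C ∈ F` gets a set `K(C) ⊆ C ∩ R'` with `|K(C)| ≥ β(C)`, and every element of `R'`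
lies in at most `γ` of the sets `K(C)` (with multiplicity over `F`). -/
def GoodAssignment {τ ι : Type} [DecidableEq τ] [DecidableEq ι]
    (G : ι → Finset τ) (F : Finset ι) (R' : Finset τ) (β : ι → ℕ) (γ : ℕ) : Prop :=
  ∃ K : ι → Finset τ,
    (∀ t ∈ F, K t ⊆ G t ∩ R' ∧ β t ≤ (K t).card) ∧
    (∀ i ∈ R', (F.filter (fun t => i ∈ K t)).card ≤ γ)

/-- A defect version of Hall's theorem: sets `G t` admit demands `β t` on `R` with load at most `γ`
per element as soon as every subfamily satisfies the cut condition. -/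
theorem exists_assignment_of_cut_condition {τ ι : Type} [Fintype τ] [DecidableEq τ] [Fintype ι]
    [DecidableEq ι] (G : ι → Finset τ) (R : Finset τ) (β : ι → ℕ) (γ : ℕ)
    (h : ∀ A : Finset ι, ∑ t ∈ A, β t ≤ ∑ i ∈ R, min γ (A.filter fun t => i ∈ G t).card) :
    ∃ K : ι → Finset τ, (∀ t, K t ⊆ G t ∩ R ∧ β t ≤ (K t).card) ∧
      ∀ i ∈ R, (Finset.univ.filter fun t => i ∈ K t).card ≤ γ := by
  classical
  set d : τ → ℕ := fun i => (Finset.univ.filter fun t => i ∈ G t).card with hd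
  let E : Finset (ι × τ) := Finset.univ.filter fun e => e.2 ∈ G e.1 ∧ e.2 ∈ R
  let N : ((t : ι) × Fin (β t)) ⊕ ((i : R) × Fin (d i - γ)) → Finset (ι × τ) :=
    Sum.elim (fun x => E.filter fun e => e.1 = x.1) (fun x => E.filter fun e => e.2 = x.1)
  have hall : ∀ s : Finset (((t : ι) × Fin (β t)) ⊕ ((i : R) × Fin (d i - γ))),
      s.card ≤ (s.biUnion N).card := by
    intro s
    let A : Finset ι := s.toLeft.image Sigma.fst
    let I : Finset τ := s.toRight.image fun x => (x.1 : τ)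
    have hI : I ⊆ R := by
      intro i hi
      obtain ⟨x, -, rfl⟩ := Finset.mem_image.1 hi
      exact x.1.2
    have hleft : s.toLeft.card ≤ ∑ t ∈ A, β t := by
      calc s.toLeft.card ≤ (A.sigma fun t => (Finset.univ : Finset (Fin (β t)))).card :=
            Finset.card_le_card fun x hx =>
              Finset.mem_sigma.2 ⟨Finset.mem_image_of_mem _ hx, Finset.mem_univ _⟩
        _ = _ := by simp
    have hright : s.toRight.card ≤ ∑ i ∈ I, (d i - γ) := by
      calc s.toRight.card ≤ ((R.attach.filter fun i : R => (i : τ) ∈ I).sigma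
              fun i : R => (Finset.univ : Finset (Fin (d i - γ)))).card :=
            Finset.card_le_card fun x hx => Finset.mem_sigma.2 ⟨Finset.mem_filter.2
              ⟨Finset.mem_attach _ _, Finset.mem_image_of_mem (fun y => (y.1 : τ)) hx⟩,
              Finset.mem_univ _⟩
        _ = ∑ i ∈ R.attach.filter (fun i : R => (i : τ) ∈ I), (d i - γ) := by simp
        _ = ∑ i ∈ I, (d i - γ) := by
          refine Finset.sum_bij (fun i _ => (i : τ)) ?_ ?_ ?_ ?_
          · intro a ha; exact (Finset.mem_filter.1 ha).2
          · intro a _ b _ hab; exact Subtype.ext hab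
          · intro b hb; exact ⟨⟨b, hI hb⟩, by simp [hb], rfl⟩
          · intro a _; rfl
    have hN : s.biUnion N = E.filter fun e => e.1 ∈ A ∨ e.2 ∈ I := by
      ext e
      simp only [Finset.mem_biUnion, Finset.mem_filter, A, I, Finset.mem_image,
        Finset.mem_toLeft, Finset.mem_toRight]
      constructor
      · rintro ⟨x | x, hx, he⟩
        · have := Finset.mem_filter.1 he
          exact ⟨this.1, Or.inl ⟨x, hx, this.2.symm⟩⟩
        · have := Finset.mem_filter.1 he
          exact ⟨this.1, Or.inr ⟨x, hx, this.2.symm⟩⟩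
      · rintro ⟨he, ⟨x, hx, hxe⟩ | ⟨x, hx, hxe⟩⟩
        · exact ⟨_, hx, Finset.mem_filter.2 ⟨he, hxe.symm⟩⟩
        · exact ⟨_, hx, Finset.mem_filter.2 ⟨he, hxe.symm⟩⟩
    have hcard : (s.biUnion N).card =
        ∑ i ∈ R, if i ∈ I then d i else (A.filter fun t => i ∈ G t).card := by
      rw [hN, Finset.card_eq_sum_card_fiberwise (f := Prod.snd) (t := R)]
      · refine Finset.sum_congr rfl fun i hi => ?_
        have : (Finset.filter (fun e : ι × τ => e.2 = i) (E.filter fun e => e.1 ∈ A ∨ e.2 ∈ I))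
            = (Finset.univ.filter fun t => i ∈ G t ∧ (t ∈ A ∨ i ∈ I)).image fun t => (t, i) := by
          ext ⟨t, j⟩
          simp only [E, Finset.mem_filter, Finset.mem_univ, true_and, Finset.mem_image,
            Prod.mk.injEq]
          constructor
          · rintro ⟨⟨⟨h1, h2⟩, h3⟩, rfl⟩
            exact ⟨t, ⟨h1, h3⟩, rfl, rfl⟩
          · rintro ⟨t', ⟨h1, h3⟩, rfl, rfl⟩
            exact ⟨⟨⟨h1, hi⟩, h3⟩, rfl⟩
        rw [this, Finset.card_image_of_injective _ (Prod.mk_left_injective i)]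
        split_ifs with hiI
        · simp [hiI, hd]
        · congr 1
          ext t
          simp [hiI, and_comm]
      · intro e he
        simp only [E, Finset.coe_filter, Finset.mem_filter, Set.mem_ofPred_eq] at he
        exact he.1.2.2
    have hsum : ∑ i ∈ I, (d i - γ) = ∑ i ∈ R, if i ∈ I then d i - γ else 0 := by
      rw [← Finset.sum_filter, Finset.filter_mem_eq_inter, Finset.inter_eq_right.2 hI]
    calc s.card = s.toLeft.card + s.toRight.card := Finset.card_toLeft_add_card_toRight.symm
      _ ≤ ∑ i ∈ R, min γ (A.filter fun t => i ∈ G t).card +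
            ∑ i ∈ R, if i ∈ I then d i - γ else 0 :=
          add_le_add (hleft.trans (h A)) (hright.trans hsum.le)
      _ ≤ (s.biUnion N).card := by
          rw [hcard, ← Finset.sum_add_distrib]
          refine Finset.sum_le_sum fun i _ => ?_
          have : (A.filter fun t => i ∈ G t).card ≤ d i :=
            Finset.card_le_card (Finset.filter_subset_filter _ (Finset.subset_univ _))
          split_ifs <;> omega
  obtain ⟨f, hf, hfN⟩ := (Finset.all_card_le_biUnion_card_iff_exists_injective N).1 hall
  have hl : ∀ t j, (f (Sum.inl ⟨t, j⟩)).1 = t ∧ (f (Sum.inl ⟨t, j⟩)).2 ∈ G t ∩ R := by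
    intro t j
    have h1 := Finset.mem_filter.1 (hfN (Sum.inl ⟨t, j⟩))
    have h2 := (Finset.mem_filter.1 h1.1).2
    have h3 : (f (Sum.inl ⟨t, j⟩)).1 = t := h1.2
    rw [h3] at h2
    exact ⟨h3, Finset.mem_inter.2 h2⟩
  refine ⟨fun t => Finset.univ.image fun j : Fin (β t) => (f (Sum.inl ⟨t, j⟩)).2, ?_, ?_⟩
  · intro t
    constructor
    · intro i hi
      obtain ⟨j, -, rfl⟩ := Finset.mem_image.1 hi
      exact (hl t j).2
    · rw [Finset.card_image_of_injective, Finset.card_univ, Fintype.card_fin]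
      intro j j' hjj
      have := hf (Prod.ext ((hl t j).1.trans (hl t j').1.symm) hjj)
      simpa using this
  · intro i hi
    set U := Finset.univ.filter fun t => i ∈
      Finset.univ.image fun j : Fin (β t) => (f (Sum.inl ⟨t, j⟩)).2 with hU
    let V : Finset ι := Finset.univ.image
      fun j : Fin (d i - γ) => (f (Sum.inr ⟨⟨i, hi⟩, j⟩)).1
    have hr : ∀ j, (f (Sum.inr ⟨⟨i, hi⟩, j⟩)).2 = i ∧ i ∈ G (f (Sum.inr ⟨⟨i, hi⟩, j⟩)).1 := by
      intro j
      have h1 := Finset.mem_filter.1 (hfN (Sum.inr ⟨⟨i, hi⟩, j⟩))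
      have h2 := (Finset.mem_filter.1 h1.1).2.1
      have h3 : (f (Sum.inr ⟨⟨i, hi⟩, j⟩)).2 = i := h1.2
      rw [h3] at h2
      exact ⟨h3, h2⟩
    have hV : V.card = d i - γ := by
      rw [Finset.card_image_of_injective, Finset.card_univ, Fintype.card_fin]
      intro j j' hjj
      have := hf (Prod.ext hjj ((hr j).1.trans (hr j').1.symm))
      simpa using this
    have hdisj : Disjoint U V := by
      rw [Finset.disjoint_left]
      intro t htU htV
      obtain ⟨j, -, hj⟩ := Finset.mem_image.1 (Finset.mem_filter.1 htU).2
      obtain ⟨j', -, hj'⟩ := Finset.mem_image.1 htV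
      have := hf (Prod.ext ((hl t j).1.trans hj'.symm) (hj.trans (hr j').1.symm))
      simp at this
    have hUV : (U ∪ V).card ≤ d i := by
      refine Finset.card_le_card (Finset.union_subset ?_ ?_)
      · intro t ht
        obtain ⟨j, -, hj⟩ := Finset.mem_image.1 (Finset.mem_filter.1 ht).2
        have := (Finset.mem_inter.1 (hl t j).2).1
        rw [hj] at this
        simpa using this
      · intro t ht
        obtain ⟨j', -, rfl⟩ := Finset.mem_image.1 ht
        simpa using (hr j').2
    rw [Finset.card_union_of_disjoint hdisj] at hUV
    omega

/-- A good assignment satisfies the cut condition. -/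
theorem GoodAssignment.sum_le {τ ι : Type} [DecidableEq τ] [DecidableEq ι]
    {G : ι → Finset τ} {F : Finset ι} {R : Finset τ} {β : ι → ℕ} {γ : ℕ}
    (h : GoodAssignment G F R β γ) {A : Finset ι} (hA : A ⊆ F) :
    ∑ t ∈ A, β t ≤ ∑ i ∈ R, min γ (A.filter fun t => i ∈ G t).card := by
  obtain ⟨K, hK, hγ⟩ := h
  calc ∑ t ∈ A, β t ≤ ∑ t ∈ A, (K t).card := Finset.sum_le_sum fun t ht => (hK t (hA ht)).2
    _ = ∑ t ∈ A, (R.filter fun i => i ∈ K t).card := by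
        refine Finset.sum_congr rfl fun t ht => ?_
        rw [Finset.filter_mem_eq_inter, Finset.inter_eq_right.2]
        exact (hK t (hA ht)).1.trans Finset.inter_subset_right
    _ = ∑ i ∈ R, (A.filter fun t => i ∈ K t).card := by
        simp only [Finset.card_filter]
        exact Finset.sum_comm
    _ ≤ _ := by
        refine Finset.sum_le_sum fun i hi => le_min ?_ ?_
        · exact (Finset.card_le_card (Finset.filter_subset_filter _ hA)).trans (hγ i hi)
        · refine Finset.card_le_card fun t ht => ?_
          rw [Finset.mem_filter] at ht ⊢
          exact ⟨ht.1, (Finset.mem_inter.1 ((hK t (hA ht.1)).1 ht.2)).1⟩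

theorem goodAssignment_of_cut_condition {τ ι : Type} [Fintype τ] [DecidableEq τ] [Fintype ι]
    [DecidableEq ι] {G : ι → Finset τ} {F : Finset ι} {R : Finset τ} {β : ι → ℕ} {γ : ℕ}
    (h : ∀ A ⊆ F, ∑ t ∈ A, β t ≤ ∑ i ∈ R, min γ (A.filter fun t => i ∈ G t).card) :
    GoodAssignment G F R β γ := by
  obtain ⟨K, hK, hγ⟩ := exists_assignment_of_cut_condition G R
    (fun t => if t ∈ F then β t else 0) γ (by
      intro A
      rw [← Finset.sum_filter, Finset.filter_mem_eq_inter]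
      refine (h _ Finset.inter_subset_right).trans (Finset.sum_le_sum fun i _ => ?_)
      exact min_le_min le_rfl (Finset.card_le_card
        (Finset.filter_subset_filter _ Finset.inter_subset_left)))
  refine ⟨K, fun t ht => ⟨(hK t).1, by simpa [ht] using (hK t).2⟩, fun i hi => ?_⟩
  exact (Finset.card_le_card (Finset.filter_subset_filter _ (Finset.subset_univ _))).trans (hγ i hi)

theorem isProbabilityMeasure_bernoulliMeasure {p : ENNReal} (hp : p ≤ 1) :
    IsProbabilityMeasure (bernoulliMeasure p) :=
  ⟨by simp [bernoulliMeasure, add_tsub_cancel_of_le hp]⟩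

theorem integral_bernoulliMeasure {p : ENNReal} (hp : p ≤ 1) (f : Bool → ℝ) :
    ∫ b, f b ∂bernoulliMeasure p = p.toReal * f true + (1 - p.toReal) * f false := by
  have hp' : p ≠ ⊤ := ne_top_of_le_ne_top ENNReal.one_ne_top hp
  rw [bernoulliMeasure, integral_add_measure]
  · simp [integral_smul_measure, ENNReal.toReal_sub_of_le hp]
  · exact (Integrable.of_finite).smul_measure hp'
  · exact (Integrable.of_finite).smul_measure (by simp)

/-- Upper tail bound for the weight kept by a random subset, when the weights are at most `ℓ`. -/
theorem keepMeasure_tail_le {S : Type} [Fintype S] [DecidableEq S] (R : Finset S) (w : S → ℕ)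
    {ℓ : ℕ} (hℓ : 1 ≤ ℓ) (hw : ∀ i, w i ≤ ℓ) {δ a : ℝ} (hδ : 0 < δ) (hδ1 : δ ≤ 1) :
    keepMeasure S (ℓ : ENNReal)⁻¹
      {ω | a ≤ ∑ i ∈ R.filter (fun i => ω i), (w i : ℝ) ∧
        ∑ i ∈ R, (w i : ℝ) < ℓ * (1 - δ / 2) * ∑ i ∈ R.filter (fun i => ω i), (w i : ℝ)} ≤
      ENNReal.ofReal (Real.exp (-(δ ^ 2 * a / (16 * ℓ)))) := by
  have hp : (ℓ : ENNReal)⁻¹ ≤ 1 := by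
    rw [ENNReal.inv_le_one]; exact_mod_cast hℓ
  have hℓ0 : (0 : ℝ) < ℓ := by exact_mod_cast hℓ
  have := isProbabilityMeasure_bernoulliMeasure hp
  have hprob : IsProbabilityMeasure (keepMeasure S (ℓ : ENNReal)⁻¹) := by
    unfold keepMeasure; infer_instance
  set μ := keepMeasure S (ℓ : ENNReal)⁻¹ with hμ
  set c : ℝ := δ / (4 * ℓ) with hc
  have hc0 : 0 < c := by positivity
  let g : S → Bool → ℝ := fun i b => if i ∈ R ∧ b = true then Real.exp (c * w i) else 1
  have hg : ∀ ω : S → Bool, ∏ i, g i (ω i) =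
      Real.exp (c * ∑ i ∈ R.filter (fun i => ω i), (w i : ℝ)) := by
    intro ω
    rw [Finset.mul_sum, Real.exp_sum]
    simp only [g]
    rw [← Finset.prod_filter]
    refine Finset.prod_congr ?_ fun _ _ => rfl
    ext i; simp
  have hfac : ∀ i, ∫ b, g i b ∂bernoulliMeasure (ℓ : ENNReal)⁻¹ ≤
      Real.exp (if i ∈ R then c * (1 + δ / 4) * w i / ℓ else 0) := by
    intro i
    rw [integral_bernoulliMeasure hp]
    by_cases hi : i ∈ R
    · simp only [g, hi, true_and, if_true, ENNReal.toReal_inv, ENNReal.toReal_natCast]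
      have hx0 : 0 ≤ c * w i := by positivity
      have hx1 : c * w i ≤ δ / 4 := by
        have : (w i : ℝ) ≤ ℓ := by exact_mod_cast hw i
        calc c * w i ≤ c * ℓ := by gcongr
          _ = δ / 4 := by rw [hc]; field_simp
      have hexp : Real.exp (c * w i) ≤ 1 + c * w i + (c * w i) ^ 2 := by
        have := Real.abs_exp_sub_one_sub_id_le (x := c * w i)
          (by rw [abs_of_nonneg hx0]; linarith)
        have := (abs_le.1 this).2
        linarith
      have hexp' : Real.exp (c * w i) - 1 ≤ c * (1 + δ / 4) * w i := by nlinarith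
      have : (ℓ : ℝ)⁻¹ * (Real.exp (c * w i) - 1) ≤ c * (1 + δ / 4) * w i / ℓ := by
        rw [div_eq_inv_mul]; gcongr
      have h2 := Real.add_one_le_exp (c * (1 + δ / 4) * w i / ℓ)
      simp only [Bool.false_eq_true, if_false]
      linarith
    · simp [g, hi]
  have hint : ∫ ω, Real.exp (c * ∑ i ∈ R.filter (fun i => ω i), (w i : ℝ)) ∂μ ≤
      Real.exp (c * (1 + δ / 4) * (∑ i ∈ R, (w i : ℝ)) / ℓ) := by
    simp only [← hg]
    rw [hμ, keepMeasure, integral_fintype_prod_eq_prod]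
    calc _ ≤ ∏ i, Real.exp (if i ∈ R then c * (1 + δ / 4) * w i / ℓ else 0) := by
          refine Finset.prod_le_prod (fun i _ => ?_) (fun i _ => hfac i)
          refine integral_nonneg fun b => ?_
          simp only [g]
          split_ifs <;> positivity
      _ = _ := by
          rw [← Real.exp_sum, ← Finset.sum_filter, Finset.mul_sum, Finset.sum_div]
          simp
  set Y : ℝ := ∑ i ∈ R, (w i : ℝ) with hY
  set e : ℝ := c * (1 + δ / 4) * Y / ℓ + c * δ / 4 * a with he
  have hmarkov := mul_meas_ge_le_integral_of_nonneg (μ := μ)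
    (f := fun ω : S → Bool => Real.exp (c * ∑ i ∈ R.filter (fun i => ω i), (w i : ℝ)))
    (Filter.Eventually.of_forall fun ω => (Real.exp_pos _).le) Integrable.of_finite (Real.exp e)
  have hreal : μ.real {ω : S → Bool | Real.exp e ≤
      Real.exp (c * ∑ i ∈ R.filter (fun i => ω i), (w i : ℝ))} ≤
      Real.exp (-(δ ^ 2 * a / (16 * ℓ))) := by
    have h1 := hmarkov.trans hint
    have h2 : c * (1 + δ / 4) * Y / ℓ = e + -(δ ^ 2 * a / (16 * ℓ)) := by
      rw [he, hc]; field_simp; ring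
    rw [h2, Real.exp_add e] at h1
    exact le_of_mul_le_mul_left h1 (Real.exp_pos e)
  refine (measure_mono ?_).trans ((ENNReal.le_ofReal_iff_toReal_le (measure_ne_top μ _)
    (Real.exp_pos _).le).2 hreal)
  rintro ω ⟨h1, h2⟩
  simp only [Set.mem_ofPred_eq, Real.exp_le_exp]
  set X := ∑ i ∈ R.filter (fun i => ω i), (w i : ℝ) with hX
  have hX0 : 0 ≤ X := Finset.sum_nonneg fun _ _ => by positivity
  have h3 : Y / ℓ ≤ (1 - δ / 2) * X := by
    rw [div_le_iff₀ hℓ0]; linarith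
  have h4 : (1 + δ / 4) * (Y / ℓ) + δ / 4 * a ≤ X := by
    have h5 : (1 + δ / 4) * (Y / ℓ) ≤ (1 + δ / 4) * ((1 - δ / 2) * X) := by gcongr
    have h6 : δ / 4 * a ≤ δ / 4 * X := by gcongr
    nlinarith [mul_nonneg (sq_nonneg δ) hX0]
  calc e = c * ((1 + δ / 4) * (Y / ℓ) + δ / 4 * a) := by rw [he]; ring
    _ ≤ c * X := by gcongr

/-- Deterministic part: away from the tail events, assignments lift from the kept set. -/
theorem exists_goodAssignment_lift {τ ι : Type} [Fintype τ] [DecidableEq τ] [Fintype ι]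
    [DecidableEq ι] {G : ι → Finset τ} {F : Finset ι} {R R' : Finset τ} {α : ι → ℕ} {γ : ℕ}
    {ℓ δ m : ℝ} (hℓ : 0 ≤ ℓ) (hδ : 0 < δ) (hδ1 : δ ≤ 1) (hm : 1 ≤ ℓ * (δ / 2) * m)
    (hα : ∀ t ∈ F, m ≤ α t) (hgood : GoodAssignment G F R' α γ)
    (htail : ∀ A : Finset ι, A.Nonempty →
      A.card * m ≤ ∑ i ∈ R', ((min γ (A.filter fun t => i ∈ G t).card : ℕ) : ℝ) →
      ℓ * (1 - δ / 2) * ∑ i ∈ R', ((min γ (A.filter fun t => i ∈ G t).card : ℕ) : ℝ) ≤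
        ∑ i ∈ R, ((min γ (A.filter fun t => i ∈ G t).card : ℕ) : ℝ)) :
    ∃ α' : ι → ℕ, (∀ t ∈ F, ℓ * (1 - δ) * (α t : ℝ) ≤ (α' t : ℝ)) ∧
      GoodAssignment G F R α' γ := by
  refine ⟨fun t => ⌈ℓ * (1 - δ) * (α t : ℝ)⌉₊, fun t _ => Nat.le_ceil _,
    goodAssignment_of_cut_condition fun A hA => ?_⟩
  rcases A.eq_empty_or_nonempty with rfl | hne
  · simp
  have hsum : (∑ t ∈ A, (α t : ℝ)) ≤
      ∑ i ∈ R', ((min γ (A.filter fun t => i ∈ G t).card : ℕ) : ℝ) := by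
    exact_mod_cast hgood.sum_le hA
  have hcard : A.card * m ≤ ∑ t ∈ A, (α t : ℝ) := by
    rw [← nsmul_eq_mul]
    exact Finset.card_nsmul_le_sum _ _ _ fun t ht => hα t (hA ht)
  have hY := htail A hne (hcard.trans hsum)
  have hterm : ∀ t ∈ A, (⌈ℓ * (1 - δ) * (α t : ℝ)⌉₊ : ℝ) ≤ ℓ * (1 - δ / 2) * α t := by
    intro t ht
    have h1 : 0 ≤ ℓ * (1 - δ) * (α t : ℝ) :=
      mul_nonneg (mul_nonneg hℓ (by linarith)) (Nat.cast_nonneg _)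
    have h2 := (Nat.ceil_lt_add_one h1).le
    have h3 : ℓ * (δ / 2) * m ≤ ℓ * (δ / 2) * α t :=
      mul_le_mul_of_nonneg_left (hα t (hA ht)) (by positivity)
    linarith
  have hfinal : (∑ t ∈ A, (⌈ℓ * (1 - δ) * (α t : ℝ)⌉₊ : ℝ)) ≤
      ∑ i ∈ R, ((min γ (A.filter fun t => i ∈ G t).card : ℕ) : ℝ) := by
    refine (Finset.sum_le_sum hterm).trans ?_
    rw [← Finset.mul_sum]
    refine (mul_le_mul_of_nonneg_left hsum ?_).trans hY
    exact mul_nonneg hℓ (by linarith)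
  exact_mod_cast hfinal

theorem sum_pow_card_nonempty_le {ι : Type} [Fintype ι] [DecidableEq ι] {q : ℝ} (hq : 0 ≤ q)
    (h : Fintype.card ι * q ≤ 1) :
    ∑ A : Finset ι with A.Nonempty, q ^ A.card ≤ 2 * (Fintype.card ι * q) := by
  have h1 : ∑ A : Finset ι, q ^ A.card = (q + 1) ^ Fintype.card ι := by
    have := Fintype.sum_pow_mul_eq_add_pow ι q 1
    simpa using this
  have h2 : ∑ A : Finset ι, q ^ A.card =
      1 + ∑ A : Finset ι with A.Nonempty, q ^ A.card := by
    rw [← Finset.sum_filter_add_sum_filter_not Finset.univ (fun A : Finset ι => A.Nonempty),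
      add_comm]
    congr 1
    have : (Finset.univ.filter fun A : Finset ι => ¬ A.Nonempty) = {∅} := by
      ext A; simp [Finset.not_nonempty_iff_eq_empty]
    rw [this, Finset.sum_singleton, Finset.card_empty, pow_zero]
  have h3 : (q + 1) ^ Fintype.card ι ≤ Real.exp (Fintype.card ι * q) := by
    rw [Real.exp_nat_mul]
    exact pow_le_pow_left₀ (by positivity) (Real.add_one_le_exp q) _
  have h4 : Real.exp (Fintype.card ι * q) ≤ 1 + 2 * (Fintype.card ι * q) := by
    have h0 : 0 ≤ Fintype.card ι * q := by positivity
    have := (abs_le.1 (Real.abs_exp_sub_one_le (x := Fintype.card ι * q)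
      (by rwa [abs_of_nonneg h0]))).2
    rw [abs_of_nonneg h0] at this
    linarith
  linarith

/-- With probability at least `1 − 1/n¹⁰` over the random kept set
`R_{k+1}`, simultaneously for every subfamily `F ⊆ 𝒢`, every admissible `α` and every
`γ ∈ {1,…,ℓ}`: an `(α,γ)`-good assignment of `R_{k+1}` to `F` yields an `(α',γ)`-good
assignment of `R_k` to `F` with `α'(C) ≥ ℓ·(1 − 1/log n)·α(C)`. -/
theorem good_assignment_lifting
    (n ℓ : ℕ) (hn : 3 ≤ n) (hℓ : (300000 : ℝ) * Real.log n ^ 3 ≤ (ℓ : ℝ))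
    (τ : Type) [Fintype τ] [DecidableEq τ] (Rk : Finset τ)
    (ι : Type) [Fintype ι] [DecidableEq ι]
    (G : ι → Finset τ) (hfam : Fintype.card ι ≤ n * ℓ)
    (hsub : ∀ t : ι, G t ⊆ Rk)
    (hsize : ∀ t : ι, (ℓ : ℝ) ^ 4 / 2 ≤ ((G t).card : ℝ))
    (hdeg : ∀ i ∈ Rk, (Finset.univ.filter (fun t : ι => i ∈ G t)).card ≤ ℓ) :
    1 - 1 / (n : ENNReal) ^ 10 ≤
      keepMeasure τ (ℓ : ENNReal)⁻¹
        {ω : τ → Bool |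
          ∀ F : Finset ι, ∀ α : ι → ℕ,
            (∀ t ∈ F, (ℓ : ℝ) ^ 3 / 1000 ≤ (α t : ℝ) ∧ α t ≤ n) →
            ∀ γ : ℕ, 1 ≤ γ → γ ≤ ℓ →
            GoodAssignment G F (Rk.filter fun i => ω i) α γ →
            ∃ α' : ι → ℕ,
              (∀ t ∈ F, (ℓ : ℝ) * (1 - 1 / Real.log n) * (α t : ℝ) ≤ (α' t : ℝ)) ∧
              GoodAssignment G F Rk α' γ} := by
  have hn3 : (3 : ℝ) ≤ n := by exact_mod_cast hn
  have hn0 : (0 : ℝ) < n := by linarith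
  have hL : 1 < Real.log n := by
    rw [Real.lt_log_iff_exp_lt hn0]
    linarith [Real.exp_one_lt_d9]
  have hℓbig : (300000 : ℝ) ≤ ℓ := by
    have : (1 : ℝ) ≤ Real.log n ^ 3 := one_le_pow₀ hL.le
    linarith
  have hℓ0 : (0 : ℝ) < ℓ := by linarith
  have hℓ1 : 1 ≤ ℓ := by exact_mod_cast (by linarith : (1 : ℝ) ≤ ℓ)
  have hp : (ℓ : ENNReal)⁻¹ ≤ 1 := by
    rw [ENNReal.inv_le_one]; exact_mod_cast hℓ1
  have := isProbabilityMeasure_bernoulliMeasure hp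
  have hprob : IsProbabilityMeasure (keepMeasure τ (ℓ : ENNReal)⁻¹) := by
    unfold keepMeasure; infer_instance
  set μ := keepMeasure τ (ℓ : ENNReal)⁻¹ with hμ
  set δ : ℝ := 1 / Real.log n with hδdef
  have hδ : 0 < δ := by positivity
  have hδ1 : δ ≤ 1 := by
    rw [hδdef, div_le_one (by linarith)]; exact hL.le
  have hδℓ : 300000 ≤ ℓ * δ := by
    have h1 : Real.log n ≤ Real.log n ^ 3 := le_self_pow₀ hL.le (by norm_num)
    rw [hδdef, mul_one_div, le_div_iff₀ (by linarith)]
    linarith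
  have hm : 1 ≤ ℓ * (δ / 2) * ((ℓ : ℝ) ^ 3 / 1000) := by
    have h1 : (300000 : ℝ) ^ 3 ≤ (ℓ : ℝ) ^ 3 := by gcongr
    nlinarith
  rcases lt_or_ge n ℓ with hlt | hle
  · refine tsub_le_self.trans (le_of_eq ?_)
    rw [← measure_univ (μ := μ)]
    congr 1
    refine (Set.eq_univ_of_forall fun ω F α hα γ _ _ _ => ?_).symm
    have hF : F = ∅ := by
      rw [Finset.eq_empty_iff_forall_notMem]
      intro t ht
      obtain ⟨h1, h2⟩ := hα t ht
      have h3 : (α t : ℝ) < ℓ := by exact_mod_cast h2.trans_lt hlt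
      nlinarith [mul_self_nonneg (ℓ : ℝ), mul_pos hℓ0 hℓ0]
    subst hF
    exact ⟨α, by simp, fun _ => ∅, by simp, by simp⟩
  let w : Finset ι → ℕ → τ → ℕ := fun A γ i => min γ (A.filter fun t => i ∈ G t).card
  let bad : Finset ι × ℕ → Set (τ → Bool) := fun x =>
    {ω | x.1.card * ((ℓ : ℝ) ^ 3 / 1000) ≤ ∑ i ∈ Rk.filter (fun i => ω i), (w x.1 x.2 i : ℝ) ∧
      ∑ i ∈ Rk, (w x.1 x.2 i : ℝ) <
        ℓ * (1 - δ / 2) * ∑ i ∈ Rk.filter (fun i => ω i), (w x.1 x.2 i : ℝ)}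
  let J : Finset (Finset ι × ℕ) :=
    (Finset.univ.filter fun A : Finset ι => A.Nonempty) ×ˢ Finset.Icc 1 ℓ
  set q : ℝ := ((n : ℝ) ^ 14)⁻¹ with hq
  have hq0 : 0 ≤ q := by positivity
  have hbad : ∀ x ∈ J, μ (bad x) ≤ ENNReal.ofReal (q ^ x.1.card) := by
    rintro ⟨A, γ⟩ hx
    have hγ : γ ≤ ℓ := (Finset.mem_Icc.1 (Finset.mem_product.1 hx).2).2
    refine (keepMeasure_tail_le Rk (w A γ) hℓ1 (fun i => (min_le_left _ _).trans hγ) hδ hδ1).trans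
      (ENNReal.ofReal_le_ofReal ?_)
    have hqexp : q = Real.exp (-(14 * Real.log n)) := by
      rw [Real.exp_neg, hq, ← Real.exp_log hn0, ← Real.exp_nat_mul, Real.log_exp]
      norm_num
    rw [hqexp, ← Real.exp_nat_mul, Real.exp_le_exp]
    have h1 : 14 * Real.log n ≤ δ ^ 2 * ((ℓ : ℝ) ^ 3 / 1000) / (16 * ℓ) := by
      have h2 : δ ^ 2 * ((ℓ : ℝ) ^ 3 / 1000) / (16 * ℓ) = (ℓ * δ) * (ℓ * δ) / 16000 := by
        field_simp; norm_num
      have h3 : 300000 * Real.log n ≤ ℓ * δ := by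
        have h4 : Real.log n ^ 2 ≤ Real.log n ^ 3 := pow_le_pow_right₀ hL.le (by norm_num)
        rw [hδdef, mul_one_div, le_div_iff₀ (by linarith)]
        nlinarith
      rw [h2]
      nlinarith
    have h5 : (A.card : ℝ) * (14 * Real.log n) ≤
        A.card * (δ ^ 2 * ((ℓ : ℝ) ^ 3 / 1000) / (16 * ℓ)) := by gcongr
    calc _ = -(A.card * (δ ^ 2 * ((ℓ : ℝ) ^ 3 / 1000) / (16 * ℓ))) := by ring
      _ ≤ _ := by linarith
  have hcard : (Fintype.card ι : ℝ) ≤ n ^ 2 := by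
    have h1 : Fintype.card ι ≤ n * n := hfam.trans (Nat.mul_le_mul_left n hle)
    rw [sq]; exact_mod_cast h1
  have hcq : Fintype.card ι * q ≤ ((n : ℝ) ^ 12)⁻¹ := by
    calc Fintype.card ι * q ≤ (n : ℝ) ^ 2 * q := by gcongr
      _ = ((n : ℝ) ^ 12)⁻¹ := by rw [hq]; field_simp
  have hunion : μ (⋃ x ∈ J, bad x) ≤ 1 / (n : ENNReal) ^ 10 := by
    have hsum : ∑ x ∈ J, q ^ x.1.card ≤ 1 / (n : ℝ) ^ 10 := by
      rw [Finset.sum_product]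
      simp only [Finset.sum_const, Nat.card_Icc, add_tsub_cancel_right, nsmul_eq_mul]
      rw [← Finset.mul_sum]
      have h1 := sum_pow_card_nonempty_le hq0
        (hcq.trans (inv_le_one_of_one_le₀ (one_le_pow₀ (by linarith))))
      have h2 : (ℓ : ℝ) ≤ n := by exact_mod_cast hle
      calc _ ≤ (n : ℝ) * (2 * ((n : ℝ) ^ 12)⁻¹) := by
            gcongr
            exact h1.trans (by gcongr)
        _ = (2 / n) * (1 / (n : ℝ) ^ 10) := by field_simp
        _ ≤ 1 * (1 / (n : ℝ) ^ 10) := by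
            gcongr
            rw [div_le_one hn0]; linarith
        _ = _ := one_mul _
    calc μ (⋃ x ∈ J, bad x) ≤ ∑ x ∈ J, μ (bad x) := measure_biUnion_finset_le _ _
      _ ≤ ∑ x ∈ J, ENNReal.ofReal (q ^ x.1.card) := Finset.sum_le_sum hbad
      _ = ENNReal.ofReal (∑ x ∈ J, q ^ x.1.card) :=
          (ENNReal.ofReal_sum_of_nonneg fun _ _ => by positivity).symm
      _ ≤ ENNReal.ofReal (1 / (n : ℝ) ^ 10) := ENNReal.ofReal_le_ofReal hsum
      _ = 1 / (n : ENNReal) ^ 10 := by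
          rw [ENNReal.ofReal_div_of_pos (by positivity), ENNReal.ofReal_pow hn0.le]
          simp
  have hmeas : MeasurableSet (⋃ x ∈ J, bad x) := (Set.toFinite _).measurableSet
  calc 1 - 1 / (n : ENNReal) ^ 10 ≤ 1 - μ (⋃ x ∈ J, bad x) := tsub_le_tsub_left hunion 1
    _ = μ (⋃ x ∈ J, bad x)ᶜ := (prob_compl_eq_one_sub hmeas).symm
    _ ≤ _ := measure_mono ?_
  intro ω hω F α hα γ hγ1 hγ hgood
  refine exists_goodAssignment_lift hℓ0.le hδ hδ1 hm (fun t ht => (hα t ht).1) hgood ?_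
  intro A hA hX
  by_contra! hlt
  refine hω (Set.mem_biUnion (x := (A, γ)) ?_ ⟨hX, hlt⟩)
  exact Finset.mem_coe.2 (Finset.mem_product.2 ⟨by simpa using hA, Finset.mem_Icc.2 ⟨hγ1, hγ⟩⟩)
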